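/- arXiv:2303.13539 — 3 statements merged into one kernel-verified Lean document; each statement's English description precedes it below -/
import Mathlib

section
/- (Limit matrix of an absorbing Markov chain.) Let n and m be finite index types, Q an n×n real matrix with Q^k → 0 entrywise as k → ∞, R an n×m real matrix, and let P be the block matrix P = [[Q, R],[0, I]]. Then the powers P^k converge entrywise as k → ∞ to the limit matrix P_∞ = [[0, (I − Q)^{-1}·R],[0, I]]. -/
namespace Matrix

theorem fromBlocks_zero_one_pow {n m α : Type*} [Fintype n] [Fintype m] [DecidableEq n]
    [DecidableEq m] [Semiring α] (Q : Matrix n n α) (R : Matrix n m α) (k : ℕ) :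
    fromBlocks Q R (0 : Matrix m n α) (1 : Matrix m m α) ^ k =
      fromBlocks (Q ^ k) ((∑ i ∈ Finset.range k, Q ^ i) * R) 0 1 := by
  induction k with
  | zero => simp
  | succ k ih =>
    rw [pow_succ, ih, fromBlocks_multiply, Finset.sum_range_succ_comm, Matrix.add_mul]
    simp [pow_succ]

theorem isUnit_one_sub_of_tendsto_pow {n K : Type*} [Fintype n] [DecidableEq n] [Field K]
    [TopologicalSpace K] [IsTopologicalRing K] [T1Space K] {Q : Matrix n n K}
    (hQ : Filter.Tendsto (fun k : ℕ => Q ^ k) Filter.atTop (nhds 0)) : IsUnit (1 - Q) := by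
  have hdet : Filter.Tendsto (fun k : ℕ => (1 - Q ^ k).det) Filter.atTop (nhds 1) := by
    have hcont : Continuous fun A : Matrix n n K => (1 - A).det :=
      (continuous_const.sub continuous_id).matrix_det
    simpa [Function.comp_def] using (hcont.tendsto 0).comp hQ
  obtain ⟨k, hk⟩ := (hdet.eventually_ne one_ne_zero).exists
  rw [isUnit_iff_isUnit_det, isUnit_iff_ne_zero]
  rw [← mul_neg_geom_sum, det_mul] at hk
  exact left_ne_zero_of_mul hk

theorem tendsto_geom_sum_inv_one_sub {n K : Type*} [Fintype n] [DecidableEq n] [Field K]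
    [TopologicalSpace K] [IsTopologicalRing K] [T1Space K] {Q : Matrix n n K}
    (hQ : Filter.Tendsto (fun k : ℕ => Q ^ k) Filter.atTop (nhds 0)) :
    Filter.Tendsto (fun k : ℕ => ∑ i ∈ Finset.range k, Q ^ i) Filter.atTop
      (nhds (1 - Q)⁻¹) := by
  have hdet := (isUnit_iff_isUnit_det _).mp (isUnit_one_sub_of_tendsto_pow hQ)
  have hsum (k : ℕ) : ∑ i ∈ Finset.range k, Q ^ i = (1 - Q)⁻¹ * (1 - Q ^ k) := by
    rw [← mul_neg_geom_sum, nonsing_inv_mul_cancel_left _ _ hdet]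
  simp_rw [hsum]
  simpa using (hQ.const_sub 1).const_mul (1 - Q)⁻¹

end Matrix

/-- Limit matrix of an absorbing Markov chain. If `Q^k → 0` entrywise and
`P = [[Q, R], [0, I]]`, then `P^k → P_∞ = [[0, (I - Q)⁻¹ * R], [0, I]]` entrywise. -/
theorem absorbing_chain_limit_matrix {n m : Type*} [Fintype n] [Fintype m]
    [DecidableEq n] [DecidableEq m]
    (Q : Matrix n n ℝ) (R : Matrix n m ℝ)
    (hQ : Filter.Tendsto (fun k : ℕ => Q ^ k) Filter.atTop (nhds (0 : Matrix n n ℝ))) :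
    Filter.Tendsto
      (fun k : ℕ => (Matrix.fromBlocks Q R (0 : Matrix m n ℝ) (1 : Matrix m m ℝ)) ^ k)
      Filter.atTop
      (nhds (Matrix.fromBlocks (0 : Matrix n n ℝ) ((1 - Q)⁻¹ * R)
        (0 : Matrix m n ℝ) (1 : Matrix m m ℝ))) := by
  simp_rw [Matrix.fromBlocks_zero_one_pow]
  have hcont : Continuous fun A : Matrix n n ℝ × Matrix n n ℝ =>
      Matrix.fromBlocks A.1 (A.2 * R) (0 : Matrix m n ℝ) (1 : Matrix m m ℝ) :=
    continuous_fst.matrix_fromBlocks (continuous_snd.matrix_mul continuous_const)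
      continuous_const continuous_const
  exact (hcont.tendsto (0, (1 - Q)⁻¹)).comp
    (hQ.prodMk_nhds (Matrix.tendsto_geom_sum_inv_one_sub hQ))
end

section
/- (Proposition 5.2, closed-form convergence probabilities.) Let n and m be finite index types, Q an n×n real matrix with Q^k → 0 entrywise, R an n×m real matrix, P the block matrix [[Q, R],[0, I]], and let A₀ be a row vector indexed by n ⊕ m (an initial distribution over the joint policy space). Then the row vectors A₀ · P^k converge entrywise as k → ∞ to A₀ · P_∞, where P_∞ = [[0, (I − Q)^{-1}·R],[0, I]]; in particular the vector of limiting (absorption) probabilities equals A₀ · [[0, (I − Q)^{-1}·R],[0, I]]. -/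
open Filter Topology in
/-- If the powers of `Q` tend to `0`, then `1 - Q` is invertible. -/
theorem Matrix.isUnit_det_one_sub_of_tendsto_pow {n K : Type*} [Fintype n] [DecidableEq n]
    [Field K] [TopologicalSpace K] [IsTopologicalRing K] [T1Space K] {Q : Matrix n n K}
    (hQ : Tendsto (fun k : ℕ => Q ^ k) atTop (𝓝 0)) : IsUnit (1 - Q).det := by
  have hdet : Tendsto (fun k : ℕ => (1 - Q ^ k).det) atTop (𝓝 1) := by
    have hcont : Continuous fun M : Matrix n n K => (1 - M).det := by fun_prop
    simpa [Function.comp_def] using (hcont.tendsto 0).comp hQ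
  obtain ⟨k, hk⟩ := (hdet.eventually_ne one_ne_zero).exists
  rw [← mul_neg_geom_sum Q k, det_mul] at hk
  exact (left_ne_zero_of_mul hk).isUnit

/-- Powers of the block matrix `[[Q, R], [0, 1]]` when `1 - Q` is invertible. -/
theorem Matrix.fromBlocks_zero_one_pow_s5 {n m K : Type*} [Fintype n] [Fintype m] [DecidableEq n]
    [DecidableEq m] [CommRing K] {Q : Matrix n n K} (hQ : IsUnit (1 - Q).det) (R : Matrix n m K)
    (k : ℕ) :
    fromBlocks Q R (0 : Matrix m n K) (1 : Matrix m m K) ^ k =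
      fromBlocks (Q ^ k) ((1 - Q)⁻¹ * (1 - Q ^ k) * R) 0 1 := by
  induction k with
  | zero => simp
  | succ k ih =>
    have hstep : (1 - Q)⁻¹ * (1 - Q ^ (k + 1)) = Q ^ k + (1 - Q)⁻¹ * (1 - Q ^ k) := by
      calc (1 - Q)⁻¹ * (1 - Q ^ (k + 1))
          = (1 - Q)⁻¹ * (1 - Q) * Q ^ k + (1 - Q)⁻¹ * (1 - Q ^ k) := by
            rw [pow_succ']; noncomm_ring
        _ = Q ^ k + (1 - Q)⁻¹ * (1 - Q ^ k) := by rw [nonsing_inv_mul _ hQ, one_mul]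
    rw [pow_succ, ih, fromBlocks_multiply, hstep]
    simp [pow_succ, Matrix.add_mul]

/-- Proposition 5.2, closed-form convergence probabilities:
If `Q^k → 0` entrywise and `P = [[Q, R], [0, I]]`, then for any initial row vector `A₀`
over the joint policy space, `A₀ · P^k → A₀ · P_∞` entrywise, where
`P_∞ = [[0, (I - Q)⁻¹ * R], [0, I]]`. -/
theorem absorption_probabilities_closed_form {n m : Type*} [Fintype n] [Fintype m]
    [DecidableEq n] [DecidableEq m]
    (Q : Matrix n n ℝ) (R : Matrix n m ℝ)
    (hQ : Filter.Tendsto (fun k : ℕ => Q ^ k) Filter.atTop (nhds (0 : Matrix n n ℝ)))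
    (A₀ : (n ⊕ m) → ℝ) :
    Filter.Tendsto
      (fun k : ℕ =>
        Matrix.vecMul A₀
          ((Matrix.fromBlocks Q R (0 : Matrix m n ℝ) (1 : Matrix m m ℝ)) ^ k))
      Filter.atTop
      (nhds (Matrix.vecMul A₀
        (Matrix.fromBlocks (0 : Matrix n n ℝ) ((1 - Q)⁻¹ * R)
          (0 : Matrix m n ℝ) (1 : Matrix m m ℝ)))) := by
  have hdet := Matrix.isUnit_det_one_sub_of_tendsto_pow hQ
  simp only [Matrix.fromBlocks_zero_one_pow_s5 hdet]
  have hcont : Continuous fun M : Matrix n n ℝ =>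
      Matrix.vecMul A₀ (Matrix.fromBlocks M ((1 - Q)⁻¹ * (1 - M) * R)
        (0 : Matrix m n ℝ) (1 : Matrix m m ℝ)) := by
    fun_prop
  simpa [Function.comp_def] using (hcont.tendsto 0).comp hQ
end

section
/- (Reachability of absorbing states implies absorption; the matrix fact underlying 'weak acyclicity implies the policy chain is absorbing'.) Let S be a finite type and P an S×S real matrix with nonnegative entries whose rows each sum to 1 (a stochastic matrix). Let A = {a ∈ S : P(a,a) = 1} be the set of absorbing states, and suppose that for every state s ∈ S there exist k ≥ 1 and a ∈ A with (P^k)(s,a) > 0. Then the substochastic matrix Q obtained by restricting P to the transient states T = S \ A (i.e., Q(i,j) = P(i,j) for i,j ∈ T) satisfies Q^k → 0 entrywise as k → ∞. -/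
attribute [local instance] Classical.propDecidable

/-- A nonnegative matrix whose row sums are at most one, and in which each row has sum less than one
in some power of the matrix, has powers tending to zero. -/
theorem Matrix.tendsto_pow_atTop_zero_of_exists_row_sum_lt_one {T : Type*} [Fintype T]
    [DecidableEq T] (Q : Matrix T T ℝ) (hQ0 : ∀ i j, 0 ≤ Q i j) (hQ1 : ∀ i, ∑ j, Q i j ≤ 1)
    (hlt : ∀ i, ∃ k : ℕ, ∑ j, (Q ^ k) i j < 1) :
    Filter.Tendsto (fun k : ℕ => Q ^ k) Filter.atTop (nhds 0) := by
  have hpow0 : ∀ (k : ℕ) i j, 0 ≤ (Q ^ k) i j := fun k => Matrix.pow_apply_nonneg hQ0 k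
  set r : ℕ → T → ℝ := fun k => (Q ^ k).mulVec 1 with hr
  have r_apply : ∀ k i, r k i = ∑ j, (Q ^ k) i j := fun k i => by
    simp [hr, Matrix.mulVec, dotProduct]
  have r_add : ∀ k l, r (k + l) = (Q ^ k).mulVec (r l) := fun k l => by
    simp [hr, pow_add, Matrix.mulVec_mulVec]
  have r_nonneg : ∀ k i, 0 ≤ r k i := fun k i => by
    rw [r_apply]
    exact Finset.sum_nonneg fun j _ => hpow0 k i j
  have r_anti : ∀ i, Antitone fun k => r k i := fun i => antitone_nat_of_succ_le fun k => by
    rw [r_add, r_apply]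
    refine Finset.sum_le_sum fun j _ => mul_le_of_le_one_right (hpow0 k i j) ?_
    simpa [r_apply] using hQ1 j
  have r_tendsto : ∀ i, ∃ v, Filter.Tendsto (fun k => r k i) Filter.atTop (nhds v) := fun i =>
    ⟨_, tendsto_atTop_ciInf (r_anti i) ⟨0, by rintro _ ⟨k, rfl⟩; exact r_nonneg k i⟩⟩
  choose v hv using r_tendsto
  have v_nonneg : ∀ i, 0 ≤ v i := fun i => ge_of_tendsto' (hv i) fun k => r_nonneg k i
  have v_fixed : ∀ k i, v i = ∑ j, (Q ^ k) i j * v j := fun k i => by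
    have h1 : Filter.Tendsto (fun l => r (k + l) i) Filter.atTop (nhds (v i)) := by
      simpa only [add_comm k] using (Filter.tendsto_add_atTop_iff_nat k).2 (hv i)
    refine tendsto_nhds_unique h1 ?_
    simp only [r_add, Matrix.mulVec, dotProduct]
    exact tendsto_finsetSum _ fun j _ => (hv j).const_mul _
  have v_zero : ∀ i, v i = 0 := fun i => by
    have : Nonempty T := ⟨i⟩
    obtain ⟨m, hm⟩ := Finite.exists_max v
    obtain ⟨k, hk⟩ := hlt m
    have hle : v m ≤ (∑ j, (Q ^ k) m j) * v m := by
      conv_lhs => rw [v_fixed k m]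
      rw [Finset.sum_mul]
      exact Finset.sum_le_sum fun j _ => mul_le_mul_of_nonneg_left (hm j) (hpow0 k m j)
    have := hm i
    have := v_nonneg i
    nlinarith
  refine tendsto_pi_nhds.2 fun i => tendsto_pi_nhds.2 fun j => ?_
  refine squeeze_zero (fun k => hpow0 k i j) (fun k => ?_) (v_zero i ▸ hv i)
  rw [r_apply]
  exact Finset.single_le_sum (f := fun j => (Q ^ k) i j) (fun j _ => hpow0 k i j)
    (Finset.mem_univ j)

/-- The entries of a power of a principal submatrix of a nonnegative matrix are bounded by the
corresponding entries of the power of the whole matrix. -/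
theorem Matrix.submatrix_pow_apply_le {S T : Type*} [Fintype S] [DecidableEq S] [Fintype T]
    [DecidableEq T] {P : Matrix S S ℝ} (hP : ∀ s t, 0 ≤ P s t) {e : T → S}
    (he : Function.Injective e) (k : ℕ) (i j : T) :
    (P.submatrix e e ^ k) i j ≤ (P ^ k) (e i) (e j) := by
  induction k generalizing j with
  | zero => simp [Matrix.one_apply, he.eq_iff]
  | succ k ih =>
    rw [pow_succ, pow_succ, Matrix.mul_apply, Matrix.mul_apply]
    calc ∑ t, (P.submatrix e e ^ k) i t * P (e t) (e j)
        ≤ ∑ t, (P ^ k) (e i) (e t) * P (e t) (e j) :=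
          Finset.sum_le_sum fun t _ => mul_le_mul_of_nonneg_right (ih t) (hP _ _)
      _ = ∑ s ∈ Finset.univ.map ⟨e, he⟩, (P ^ k) (e i) s * P s (e j) := by simp
      _ ≤ ∑ s, (P ^ k) (e i) s * P s (e j) :=
          Finset.sum_le_sum_of_subset_of_nonneg (Finset.subset_univ _) fun s _ _ =>
            mul_nonneg (Matrix.pow_apply_nonneg hP k _ _) (hP _ _)

/-- Reachability of absorbing states implies absorption. Let `P` be a
stochastic matrix on a finite state space `S`, with absorbing states
`A = {a | P a a = 1}`. If from every state some absorbing state is reachable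
(for every `s` there are `k ≥ 1` and `a ∈ A` with `(P^k) s a > 0`), then the
substochastic matrix `Q` obtained by restricting `P` to the transient states
`T = S \ A` satisfies `Q^k → 0` entrywise. -/
theorem transient_submatrix_pow_tendsto_zero {S : Type*} [Fintype S] [DecidableEq S]
    (P : Matrix S S ℝ)
    (hP0 : ∀ s t, 0 ≤ P s t) (hP1 : ∀ s, ∑ t, P s t = 1)
    (hreach : ∀ s : S, ∃ k : ℕ, 1 ≤ k ∧ ∃ a : S, P a a = 1 ∧ 0 < (P ^ k) s a) :
    Filter.Tendsto
      (fun k : ℕ =>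
        (Matrix.of fun i j : {s : S // P s s ≠ 1} => P i.1 j.1) ^ k)
      Filter.atTop (nhds (0 : Matrix {s : S // P s s ≠ 1} {s : S // P s s ≠ 1} ℝ)) := by
  have hpow : ∀ k : ℕ, P ^ k ∈ Matrix.rowStochastic ℝ S := fun k =>
    pow_mem (Matrix.mem_rowStochastic_iff_sum.2 ⟨hP0, hP1⟩) k
  refine Matrix.tendsto_pow_atTop_zero_of_exists_row_sum_lt_one _ (fun i j => hP0 _ _)
    (fun i => ?_) (fun i => ?_)
  · calc ∑ j : {s : S // P s s ≠ 1}, P i.1 j.1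
        = ∑ s ∈ Finset.univ.map (Function.Embedding.subtype fun s => P s s ≠ 1), P i.1 s := by
          rw [Finset.sum_map]; rfl
      _ ≤ ∑ s, P i.1 s :=
          Finset.sum_le_sum_of_subset_of_nonneg (Finset.subset_univ _) fun s _ _ => hP0 _ _
      _ = 1 := hP1 i.1
  · obtain ⟨k, -, a, ha, hpos⟩ := hreach i.1
    refine ⟨k, ?_⟩
    calc _ ≤ ∑ j : {s : S // P s s ≠ 1}, (P ^ k) i.1 j.1 :=
          Finset.sum_le_sum fun j _ =>
            Matrix.submatrix_pow_apply_le hP0 Subtype.val_injective k i j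
      _ = ∑ s ∈ Finset.univ.map (Function.Embedding.subtype fun s => P s s ≠ 1),
            (P ^ k) i.1 s := by rw [Finset.sum_map]; rfl
      _ < ∑ s, (P ^ k) i.1 s :=
          Finset.sum_lt_sum_of_subset (Finset.subset_univ _) (Finset.mem_univ a) (by simp [ha])
            hpos fun s _ _ => Matrix.nonneg_of_mem_rowStochastic (hpow k)
      _ = 1 := Matrix.sum_row_of_mem_rowStochastic (hpow k) i.1
end
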